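/- arXiv:math-ph/0210030 — 6 statements merged into one kernel-verified Lean document; each statement's English description precedes it below -/
import Mathlib

section
/- Define sequences of polynomials x_k, y_k ∈ ℤ[t] by x_0 = 0, y_0 = t², x_{k+1} = x_k + y_k, y_{k+1} = y_k · x_{k+1}. Then for every k ≥ 0, the lowest-order term of y_k is t^{2(k+1)}: the coefficient of t^m in y_k is 0 for all m < 2(k+1), and the coefficient of t^{2(k+1)} in y_k equals 1. In particular the order of y_k tends to infinity, so y_k → 0 as a formal power series. -/
open Polynomial in
/-- Both sequences factor as their lowest-order monomial times a polynomial with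
constant coefficient `1`. -/
theorem exists_lowest_order_factorization (x y : ℕ → Polynomial ℤ)
    (hx0 : x 0 = 0) (hy0 : y 0 = X ^ 2)
    (hx : ∀ k, x (k + 1) = x k + y k)
    (hy : ∀ k, y (k + 1) = y k * x (k + 1)) (k : ℕ) :
    (∃ a : ℤ[X], y k = a * X ^ (2 * (k + 1)) ∧ a.coeff 0 = 1) ∧
      ∃ b : ℤ[X], x (k + 1) = b * X ^ 2 ∧ b.coeff 0 = 1 := by
  induction k with
  | zero => exact ⟨⟨1, by simp [hy0], by simp⟩, ⟨1, by simp [hx, hx0, hy0], by simp⟩⟩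
  | succ k ih =>
    obtain ⟨⟨a, ha, ha0⟩, b, hb, hb0⟩ := ih
    have hy' : y (k + 1) = (a * b) * X ^ (2 * (k + 1 + 1)) := by
      rw [hy, ha, hb]; ring
    refine ⟨⟨a * b, hy', by simp [mul_coeff_zero, ha0, hb0]⟩,
      b + a * b * X ^ (2 * (k + 1)), ?_, ?_⟩
    · rw [hx, hy', hb]; ring
    · simp [mul_coeff_zero, hb0]

/-- For the generating-function iteration `x₀ = 0`, `y₀ = t²`, `x_{k+1} = x_k + y_k`,
`y_{k+1} = y_k · x_{k+1}` in `ℤ[t]`, the lowest-order term of `y_k` is `t^{2(k+1)}`;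
in particular the order of `y_k` tends to infinity, so `y_k → 0` as a formal power
series. -/
theorem lowest_order_term_of_y (x y : ℕ → Polynomial ℤ)
    (hx0 : x 0 = 0) (hy0 : y 0 = Polynomial.X ^ 2)
    (hx : ∀ k, x (k + 1) = x k + y k)
    (hy : ∀ k, y (k + 1) = y k * x (k + 1)) :
    (∀ k : ℕ, (∀ m : ℕ, m < 2 * (k + 1) → (y k).coeff m = 0)
        ∧ (y k).coeff (2 * (k + 1)) = 1)
      ∧ ∀ N : ℕ, ∃ K : ℕ, ∀ k ≥ K, ∀ m ≤ N, (y k).coeff m = 0 := by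
  have key : ∀ k : ℕ, (∀ m : ℕ, m < 2 * (k + 1) → (y k).coeff m = 0)
      ∧ (y k).coeff (2 * (k + 1)) = 1 := by
    intro k
    obtain ⟨⟨a, ha, ha0⟩, -⟩ := exists_lowest_order_factorization x y hx0 hy0 hx hy k
    refine ⟨fun m hm => ?_, ?_⟩
    · rw [ha, Polynomial.coeff_mul_X_pow', if_neg (not_le.mpr hm)]
    · rw [ha, Polynomial.coeff_mul_X_pow', if_pos le_rfl, Nat.sub_self, ha0]
  exact ⟨key, fun N => ⟨N, fun k hk m hm => (key k).1 m (by omega)⟩⟩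
end

section
/- Define sequences of polynomials x_k, y_k ∈ ℤ[t] by x_0 = 0, y_0 = t², x_{k+1} = x_k + y_k, y_{k+1} = y_k · x_{k+1}. Then the stabilized coefficients of the limit series x(t) (equivalently, the coefficients of x_8, which agree with those of every x_k with k ≥ 8 up to degree 17) satisfy: the coefficients of t², t⁴, t⁶, t⁸, t¹⁰, t¹², t¹⁴, t¹⁶ are 1, 1, 1, 2, 3, 6, 12, 24 respectively. -/
open Polynomial

theorem dvd_sub_of_eq_add {R : Type*} [CommRing R] {d a b c p q r : R} (h : c = a + b)
    (ha : d ∣ a - p) (hb : d ∣ b - q) (hr : p + q = r) : d ∣ c - r := by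
  have e : c - r = (a - p) + (b - q) := by rw [h, ← hr]; ring
  exact e ▸ dvd_add ha hb

theorem dvd_sub_of_eq_mul {R : Type*} [CommRing R] {d a b c p q r : R} (h : c = a * b)
    (ha : d ∣ a - p) (hb : d ∣ b - q) (hr : d ∣ p * q - r) : d ∣ c - r := by
  have e : c - r = (a - p) * b + p * (b - q) + (p * q - r) := by rw [h]; ring
  exact e ▸ dvd_add (dvd_add (ha.mul_right b) (hb.mul_left p)) hr

theorem coeff_eq_of_X_pow_dvd_sub {R : Type*} [CommRing R] {n m : ℕ} {p q : R[X]}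
    (h : X ^ n ∣ p - q) (hm : m < n) : p.coeff m = q.coeff m := by
  rw [← sub_eq_zero, ← coeff_sub]
  exact X_pow_dvd_iff.mp h m hm

/-- The iterates satisfy `X² ∣ xₖ` and `X^(2k+2) ∣ yₖ`. -/
theorem X_pow_dvd_iterates {R : Type*} [CommRing R] (x y : ℕ → R[X])
    (hx0 : x 0 = 0) (hy0 : y 0 = X ^ 2)
    (hx : ∀ k, x (k + 1) = x k + y k)
    (hy : ∀ k, y (k + 1) = y k * x (k + 1)) (k : ℕ) :
    X ^ 2 ∣ x k ∧ X ^ (2 * k + 2) ∣ y k := by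
  induction k with
  | zero => simp [hx0, hy0]
  | succ k ih =>
    obtain ⟨ihx, ihy⟩ := ih
    have hxk : X ^ 2 ∣ x (k + 1) :=
      hx k ▸ dvd_add ihx ((pow_dvd_pow X (by omega)).trans ihy)
    refine ⟨hxk, ?_⟩
    rw [hy, mul_add, add_right_comm, pow_add _ (2 * k + 2)]
    exact mul_dvd_mul ihy hxk

/-- For the generating-function iteration `x₀ = 0`, `y₀ = t²`, `x_{k+1} = x_k + y_k`,
`y_{k+1} = y_k · x_{k+1}` in `ℤ[t]`, the stabilized coefficients of the limit series
`x(t)` (the coefficients of `x₈`, which agree with those of every `x_k`, `k ≥ 8`, up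
to degree 17) are: `[t²]x = 1`, `[t⁴]x = 1`, `[t⁶]x = 1`, `[t⁸]x = 2`, `[t¹⁰]x = 3`,
`[t¹²]x = 6`, `[t¹⁴]x = 12`, `[t¹⁶]x = 24`. -/
theorem initial_coefficients_of_x (x y : ℕ → Polynomial ℤ)
    (hx0 : x 0 = 0) (hy0 : y 0 = Polynomial.X ^ 2)
    (hx : ∀ k, x (k + 1) = x k + y k)
    (hy : ∀ k, y (k + 1) = y k * x (k + 1)) :
    (∀ k : ℕ, 8 ≤ k → ∀ m : ℕ, m ≤ 17 → (x k).coeff m = (x 8).coeff m)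
      ∧ (x 8).coeff 2 = 1 ∧ (x 8).coeff 4 = 1 ∧ (x 8).coeff 6 = 1
      ∧ (x 8).coeff 8 = 2 ∧ (x 8).coeff 10 = 3 ∧ (x 8).coeff 12 = 6
      ∧ (x 8).coeff 14 = 12 ∧ (x 8).coeff 16 = 24 := by
  have hx_zero : (X : ℤ[X]) ^ 18 ∣ x 0 - 0 := by simp [hx0]
  have hy_zero : (X : ℤ[X]) ^ 18 ∣ y 0 - X ^ 2 := by simp [hy0]
  have hx1 : (X : ℤ[X]) ^ 18 ∣ x 1 - (X ^ 2) :=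
    dvd_sub_of_eq_add (hx 0) hx_zero hy_zero (by ring)
  have hy1 : (X : ℤ[X]) ^ 18 ∣ y 1 - (X ^ 4) :=
    dvd_sub_of_eq_mul (hy 0) hy_zero hx1 ⟨0, by ring⟩
  have hx2 : (X : ℤ[X]) ^ 18 ∣ x 2 - (X ^ 2 + X ^ 4) :=
    dvd_sub_of_eq_add (hx 1) hx1 hy1 (by ring)
  have hy2 : (X : ℤ[X]) ^ 18 ∣ y 2 - (X ^ 6 + X ^ 8) :=
    dvd_sub_of_eq_mul (hy 1) hy1 hx2 ⟨0, by ring⟩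
  have hx3 : (X : ℤ[X]) ^ 18 ∣ x 3 - (X ^ 2 + X ^ 4 + X ^ 6 + X ^ 8) :=
    dvd_sub_of_eq_add (hx 2) hx2 hy2 (by ring)
  have hy3 : (X : ℤ[X]) ^ 18 ∣ y 3 - (X ^ 8 + 2 * X ^ 10 + 2 * X ^ 12 + 2 * X ^ 14 + X ^ 16) :=
    dvd_sub_of_eq_mul (hy 2) hy2 hx3 ⟨0, by ring⟩
  have hx4 : (X : ℤ[X]) ^ 18 ∣ x 4 - (X ^ 2 + X ^ 4 + X ^ 6 + 2 * X ^ 8 + 2 * X ^ 10 + 2 * X ^ 12 + 2 * X ^ 14 + X ^ 16) :=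
    dvd_sub_of_eq_add (hx 3) hx3 hy3 (by ring)
  have hy4 : (X : ℤ[X]) ^ 18 ∣ y 4 - (X ^ 10 + 3 * X ^ 12 + 5 * X ^ 14 + 8 * X ^ 16) :=
    dvd_sub_of_eq_mul (hy 3) hy3 hx4 ⟨11 + 13 * X ^ 2 + 15 * X ^ 4 + 15 * X ^ 6 + 12 * X ^ 8 + 8 * X ^ 10 + 4 * X ^ 12 + X ^ 14, by ring⟩
  have hx5 : (X : ℤ[X]) ^ 18 ∣ x 5 - (X ^ 2 + X ^ 4 + X ^ 6 + 2 * X ^ 8 + 3 * X ^ 10 + 5 * X ^ 12 + 7 * X ^ 14 + 9 * X ^ 16) :=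
    dvd_sub_of_eq_add (hx 4) hx4 hy4 (by ring)
  have hy5 : (X : ℤ[X]) ^ 18 ∣ y 5 - (X ^ 12 + 4 * X ^ 14 + 9 * X ^ 16) :=
    dvd_sub_of_eq_mul (hy 4) hy4 hx5 ⟨18 + 22 * X ^ 2 + 32 * X ^ 4 + 53 * X ^ 6 + 79 * X ^ 8 + 102 * X ^ 10 + 101 * X ^ 12 + 72 * X ^ 14, by ring⟩
  have hx6 : (X : ℤ[X]) ^ 18 ∣ x 6 - (X ^ 2 + X ^ 4 + X ^ 6 + 2 * X ^ 8 + 3 * X ^ 10 + 6 * X ^ 12 + 11 * X ^ 14 + 18 * X ^ 16) :=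
    dvd_sub_of_eq_add (hx 5) hx5 hy5 (by ring)
  have hy6 : (X : ℤ[X]) ^ 18 ∣ y 6 - (X ^ 14 + 5 * X ^ 16) :=
    dvd_sub_of_eq_mul (hy 5) hy5 hx6 ⟨14 + 15 * X ^ 2 + 20 * X ^ 4 + 36 * X ^ 6 + 62 * X ^ 8 + 116 * X ^ 10 + 171 * X ^ 12 + 162 * X ^ 14, by ring⟩
  have hx7 : (X : ℤ[X]) ^ 18 ∣ x 7 - (X ^ 2 + X ^ 4 + X ^ 6 + 2 * X ^ 8 + 3 * X ^ 10 + 6 * X ^ 12 + 12 * X ^ 14 + 23 * X ^ 16) :=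
    dvd_sub_of_eq_add (hx 6) hx6 hy6 (by ring)
  have hy7 : (X : ℤ[X]) ^ 18 ∣ y 7 - (X ^ 16) :=
    dvd_sub_of_eq_mul (hy 6) hy6 hx7 ⟨6 + 6 * X ^ 2 + 7 * X ^ 4 + 13 * X ^ 6 + 21 * X ^ 8 + 42 * X ^ 10 + 83 * X ^ 12 + 115 * X ^ 14, by ring⟩
  have hx8 : (X : ℤ[X]) ^ 18 ∣ x 8 - (X ^ 2 + X ^ 4 + X ^ 6 + 2 * X ^ 8 + 3 * X ^ 10 + 6 * X ^ 12 + 12 * X ^ 14 + 24 * X ^ 16) :=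
    dvd_sub_of_eq_add (hx 7) hx7 hy7 (by ring)
  constructor
  · intro k hk m hm
    induction k, hk using Nat.le_induction with
    | base => rfl
    | succ k hk ih =>
      have hyk := (X_pow_dvd_iterates x y hx0 hy0 hx hy k).2
      rw [hx, coeff_add, ih, X_pow_dvd_iff.mp hyk m (by omega), add_zero]
  · have hc := fun m (hm : m < 18) => coeff_eq_of_X_pow_dvd_sub hx8 hm
    refine ⟨?_, ?_, ?_, ?_, ?_, ?_, ?_, ?_⟩ <;>
      · rw [hc _ (by norm_num)]
        simp [coeff_X_pow, coeff_ofNat_mul]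
end

section
/- Define I : ℝ × ℝ → ℝ by I(x,y) = y + x − 1 + √(2y), and φ : ℝ² → ℝ² by φ(x,y) = (x+y, y(x+y)). If x > 0, y > 0 and I(x,y) < 0, then I(φ(x,y)) − I(x,y) ≤ −√2 · y^{3/2} < 0. In particular the region {(x,y) : x > 0, y > 0, I(x,y) < 0} is forward invariant under φ (together with its closure in {y ≥ 0}). -/
/-- The Lyapunov-type function `I(x,y) = y + x − 1 + √(2y)`. -/
noncomputable def lyap (x y : ℝ) : ℝ := y + x - 1 + Real.sqrt (2 * y)

/-- Under the map `φ(x,y) = (x+y, y(x+y))`: if `x > 0`, `y > 0` and `I(x,y) < 0`,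
then `I(φ(x,y)) − I(x,y) ≤ −√2·y^{3/2} < 0`; in particular the region
`{x > 0, y > 0, I < 0}` is forward invariant under `φ`. -/
theorem lyapunov_decreases (x y : ℝ) (hx : 0 < x) (hy : 0 < y)
    (hI : lyap x y < 0) :
    (lyap (x + y) (y * (x + y)) - lyap x y ≤ -Real.sqrt 2 * y ^ (3 / 2 : ℝ)
      ∧ -Real.sqrt 2 * y ^ (3 / 2 : ℝ) < 0)
    ∧ (0 < x + y ∧ 0 < y * (x + y) ∧ lyap (x + y) (y * (x + y)) < 0) := by
  have hs : 0 < x + y := add_pos hx hy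
  have hys : 0 < y * (x + y) := mul_pos hy hs
  unfold lyap at *
  have hpow : Real.sqrt 2 * y ^ (3 / 2 : ℝ) = y * Real.sqrt (2 * y) := by
    have h : y ^ (3 / 2 : ℝ) = y * Real.sqrt y := by
      rw [Real.sqrt_eq_rpow, show (3 / 2 : ℝ) = 1 + 1 / 2 by norm_num,
        Real.rpow_add hy, Real.rpow_one]
    rw [h, Real.sqrt_mul zero_le_two]
    ring
  have hsplit : Real.sqrt (2 * (y * (x + y))) = Real.sqrt (2 * y) * Real.sqrt (x + y) := by
    rw [← mul_assoc, Real.sqrt_mul (by positivity)]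
  have hr : 0 < Real.sqrt (2 * y) := Real.sqrt_pos.2 (by positivity)
  have hr2 : Real.sqrt (2 * y) ^ 2 = 2 * y := Real.sq_sqrt (by positivity)
  rw [neg_mul, hpow, hsplit]
  set r := Real.sqrt (2 * y)
  have hroot : Real.sqrt (x + y) ≤ 1 - r / 2 :=
    Real.sqrt_le_iff.2 ⟨by linarith, by nlinarith [sq_nonneg r]⟩
  have hneg : 0 < y * r := mul_pos hy hr
  have hdecr : y * (x + y) + (x + y) - 1 + r * Real.sqrt (x + y) - (y + x - 1 + r)
      ≤ -(y * r) := by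
    have h₁ : r * Real.sqrt (x + y) ≤ r * (1 - r / 2) := by gcongr
    have h₂ : y * (x + y) ≤ y * (1 - r) := by gcongr; linarith
    linarith
  exact ⟨⟨hdecr, by linarith⟩, hs, hys, by linarith⟩
end

section
/- For t ∈ ℝ define sequences x_k(t), y_k(t) by x_0(t) = 0, y_0(t) = t², x_{k+1}(t) = x_k(t) + y_k(t), y_{k+1}(t) = y_k(t) · x_{k+1}(t). If 0 < t² < 2 − √3, then the sequence x_k(t) is nondecreasing and converges to a limit L(t) with t² ≤ L(t) ≤ 1, and y_k(t) → 0. Consequently the iteration converges for all real t with |t| < √(2−√3), and √(2−√3) > 0.51. -/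
open Filter

/-- The region `0 ≤ x ≤ 1`, `0 ≤ y`, `3 y ≤ (1 - x)²` is mapped into itself by
`(x, y) ↦ (x + y, y (x + y))`. -/
lemma trapping_region_step {x y : ℝ} (hx : 0 ≤ x) (hx1 : x ≤ 1) (hy : 0 ≤ y)
    (hxy : 3 * y ≤ (1 - x) ^ 2) :
    0 ≤ x + y ∧ x + y ≤ 1 ∧ 0 ≤ y * (x + y) ∧ 3 * (y * (x + y)) ≤ (1 - (x + y)) ^ 2 := by
  have hyx : 2 * y ≤ 1 - x := by nlinarith
  refine ⟨by positivity, by linarith, by positivity, ?_⟩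
  nlinarith [mul_nonneg hy (sub_nonneg.2 hyx)]

lemma trapping_region_orbit {x y : ℕ → ℝ} {s : ℝ} (hs : 0 ≤ s) (hs3 : 3 * s ≤ 1)
    (hx0 : x 0 = 0) (hy0 : y 0 = s) (hx : ∀ k, x (k + 1) = x k + y k)
    (hy : ∀ k, y (k + 1) = y k * x (k + 1)) (k : ℕ) :
    0 ≤ x k ∧ x k ≤ 1 ∧ 0 ≤ y k ∧ 3 * y k ≤ (1 - x k) ^ 2 := by
  induction k with
  | zero => rw [hx0, hy0]; norm_num; exact ⟨hs, hs3⟩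
  | succ k ih =>
    obtain ⟨h1, h2, h3, h4⟩ := ih
    rw [hy, hx]
    exact trapping_region_step h1 h2 h3 h4

lemma trapping_region_orbit_converges {x y : ℕ → ℝ} {s : ℝ} (hs : 0 ≤ s) (hs3 : 3 * s ≤ 1)
    (hx0 : x 0 = 0) (hy0 : y 0 = s) (hx : ∀ k, x (k + 1) = x k + y k)
    (hy : ∀ k, y (k + 1) = y k * x (k + 1)) :
    Monotone x ∧ (∃ L : ℝ, Tendsto x atTop (nhds L) ∧ s ≤ L ∧ L ≤ 1)
      ∧ Tendsto y atTop (nhds 0) := by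
  have orbit := trapping_region_orbit hs hs3 hx0 hy0 hx hy
  have mono : Monotone x := monotone_nat_of_le_succ fun k => by
    rw [hx]; linarith [(orbit k).2.2.1]
  have bdd : BddAbove (Set.range x) := ⟨1, by rintro _ ⟨k, rfl⟩; exact (orbit k).2.1⟩
  have lim := tendsto_atTop_ciSup mono bdd
  refine ⟨mono, ⟨_, lim, ?_, ciSup_le fun k => (orbit k).2.1⟩, ?_⟩
  · calc s = x 1 := by rw [hx, hx0, hy0, zero_add]
      _ ≤ _ := le_ciSup bdd 1
  · have h := ((tendsto_add_atTop_iff_nat 1).2 lim).sub lim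
    simpa [hx] using h

/-- For the real iteration `x₀(t) = 0`, `y₀(t) = t²`, `x_{k+1} = x_k + y_k`,
`y_{k+1} = y_k · x_{k+1}`: if `0 < t² < 2 − √3` then `x_k(t)` is nondecreasing and
converges to a limit `L(t)` with `t² ≤ L(t) ≤ 1`, and `y_k(t) → 0`. Consequently
the iteration converges for all real `t` with `|t| < √(2−√3)`, and `√(2−√3) > 0.51`. -/
theorem iteration_converges_in_trapping_region (x y : ℝ → ℕ → ℝ)
    (hx0 : ∀ t, x t 0 = 0) (hy0 : ∀ t, y t 0 = t ^ 2)
    (hx : ∀ t k, x t (k + 1) = x t k + y t k)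
    (hy : ∀ t k, y t (k + 1) = y t k * x t (k + 1)) :
    (∀ t : ℝ, 0 < t ^ 2 → t ^ 2 < 2 - Real.sqrt 3 →
        Monotone (x t)
          ∧ (∃ L : ℝ, Tendsto (x t) atTop (nhds L) ∧ t ^ 2 ≤ L ∧ L ≤ 1)
          ∧ Tendsto (y t) atTop (nhds 0))
      ∧ (∀ t : ℝ, |t| < Real.sqrt (2 - Real.sqrt 3) →
          ∃ L : ℝ, Tendsto (x t) atTop (nhds L))
      ∧ (0.51 : ℝ) < Real.sqrt (2 - Real.sqrt 3) := by
  have hsqrt : (5 / 3 : ℝ) ≤ Real.sqrt 3 := Real.le_sqrt_of_sq_le (by norm_num)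
  have hsqrt' : Real.sqrt 3 < 1.7399 := by
    rw [Real.sqrt_lt' (by norm_num)]; norm_num
  have conv (t : ℝ) (ht : t ^ 2 < 2 - Real.sqrt 3) :=
    trapping_region_orbit_converges (sq_nonneg t) (by linarith) (hx0 t) (hy0 t) (hx t) (hy t)
  refine ⟨fun t _ ht => conv t ht, fun t ht => ?_, ?_⟩
  · rw [Real.lt_sqrt (abs_nonneg t), sq_abs] at ht
    obtain ⟨L, hL, -⟩ := (conv t ht).2.1
    exact ⟨L, hL⟩
  · refine Real.lt_sqrt_of_sq_lt ?_
    norm_num at hsqrt' ⊢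
    linarith
end

section
/- For t ∈ ℝ define sequences x_k(t), y_k(t) by x_0(t) = 0, y_0(t) = t², x_{k+1}(t) = x_k(t) + y_k(t), y_{k+1}(t) = y_k(t) · x_{k+1}(t). If t > 0 and there exists K with x_K(t) > 1, then x_k(t) → ∞ as k → ∞. In particular, for every real t with t² + t⁴ > 1 (for instance all t ≥ 0.79, since x_2(t) = t² + t⁴), the sequence x_k(t) tends to infinity, so the iteration diverges. -/
open Filter

/-- If `1 < x K` and `0 < y K` for some `K`, then `x` grows at least linearly from `K` on. -/
theorem tendsto_atTop_of_one_lt {x y : ℕ → ℝ} (hx : ∀ k, x (k + 1) = x k + y k)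
    (hy : ∀ k, y (k + 1) = y k * x (k + 1)) {K : ℕ} (hK : 1 < x K) (hyK : 0 < y K) :
    Tendsto x atTop atTop := by
  have growth : ∀ n : ℕ, x K + n * y K ≤ x (n + K) ∧ y K ≤ y (n + K) := by
    intro n
    induction n with
    | zero => simp
    | succ n ih =>
      obtain ⟨ihx, ihy⟩ := ih
      have hx' : x K + (n + 1 : ℕ) * y K ≤ x (n + 1 + K) := by
        rw [Nat.add_right_comm, hx]
        push_cast
        linarith
      have one_le : 1 ≤ x (n + 1 + K) := by
        have : 0 ≤ ((n + 1 : ℕ) : ℝ) * y K := by positivity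
        linarith
      refine ⟨hx', ?_⟩
      rw [Nat.add_right_comm] at one_le ⊢
      rw [hy]
      exact ihy.trans (le_mul_of_one_le_right (hyK.le.trans ihy) one_le)
  rw [← tendsto_add_atTop_iff_nat K]
  refine tendsto_atTop_mono (fun n => (growth n).1) ?_
  exact tendsto_atTop_add_const_left _ _ (tendsto_natCast_atTop_atTop.atTop_mul_const hyK)

/-- Starting from `x 0 = 0` and `0 < y 0`, the iteration preserves `0 ≤ x k` and `0 < y k`. -/
theorem iteration_nonneg_and_pos {x y : ℕ → ℝ} (hx : ∀ k, x (k + 1) = x k + y k)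
    (hy : ∀ k, y (k + 1) = y k * x (k + 1)) (hx0 : x 0 = 0) (hy0 : 0 < y 0) (k : ℕ) :
    0 ≤ x k ∧ 0 < y k := by
  induction k with
  | zero => exact ⟨hx0.ge, hy0⟩
  | succ k ih =>
    obtain ⟨ihx, ihy⟩ := ih
    have : 0 < x (k + 1) := by rw [hx]; positivity
    exact ⟨this.le, by rw [hy]; positivity⟩

/-- For the real iteration `x₀(t) = 0`, `y₀(t) = t²`, `x_{k+1} = x_k + y_k`,
`y_{k+1} = y_k · x_{k+1}`: if `t > 0` and some iterate exceeds `1`, then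
`x_k(t) → ∞`. In particular, for every real `t` with `t² + t⁴ > 1` (for instance
all `t ≥ 0.79`, since `x₂(t) = t² + t⁴`), the sequence `x_k(t)` tends to infinity,
so the iteration diverges. -/
theorem iteration_diverges (x y : ℝ → ℕ → ℝ)
    (hx0 : ∀ t, x t 0 = 0) (hy0 : ∀ t, y t 0 = t ^ 2)
    (hx : ∀ t k, x t (k + 1) = x t k + y t k)
    (hy : ∀ t k, y t (k + 1) = y t k * x t (k + 1)) :
    (∀ t : ℝ, 0 < t → (∃ K : ℕ, 1 < x t K) → Tendsto (x t) atTop atTop)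
      ∧ ∀ t : ℝ, 1 < t ^ 2 + t ^ 4 → Tendsto (x t) atTop atTop := by
  have diverges (t : ℝ) (ht : t ≠ 0) (K : ℕ) (hK : 1 < x t K) : Tendsto (x t) atTop atTop := by
    have hy0' : 0 < y t 0 := by rw [hy0]; positivity
    exact tendsto_atTop_of_one_lt (hx t) (hy t) hK
      (iteration_nonneg_and_pos (hx t) (hy t) (hx0 t) hy0' K).2
  refine ⟨fun t ht ⟨K, hK⟩ => diverges t ht.ne' K hK, fun t ht => diverges t ?_ 2 ?_⟩
  · rintro rfl
    norm_num at ht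
  · have hx2 : x t 2 = t ^ 2 + t ^ 4 := by
      rw [hx t 1, hy t 0, hx t 0, hx0, hy0]
      ring
    rwa [hx2]
end

section
/- For t ∈ ℝ define sequences x_k(t), y_k(t) by x_0(t) = 0, y_0(t) = t², x_{k+1}(t) = x_k(t) + y_k(t), y_{k+1}(t) = y_k(t) · x_{k+1}(t), and for 0 ≤ t < √(2−√3) let L(t) = lim_{k→∞} x_k(t) (which exists). Then L is strictly increasing on [0, √(2−√3)): if 0 ≤ s < t < √(2−√3) then L(s) < L(t). Consequently the function t ↦ 1 − t − L(t) is strictly decreasing on [0, √(2−√3)) and has at most one zero there. -/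
open Filter

/-- The iteration `x_{k+1} = x_k + y_k`, `y_{k+1} = y_k x_{k+1}` preserves nonnegativity and is
monotone in its starting data; moreover the gap between the `x`-components of two ordered orbits
is, after one step, at least the initial gap of the `y`-components. -/
lemma iteration_monotone {x y x' y' : ℕ → ℝ}
    (hx0 : x 0 = 0) (hx0' : x' 0 = 0) (hy0 : 0 ≤ y 0) (hyy0 : y 0 ≤ y' 0)
    (hx : ∀ k, x (k + 1) = x k + y k) (hy : ∀ k, y (k + 1) = y k * x (k + 1))
    (hx' : ∀ k, x' (k + 1) = x' k + y' k) (hy' : ∀ k, y' (k + 1) = y' k * x' (k + 1)) (k : ℕ) :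
    0 ≤ x (k + 1) ∧ 0 ≤ y (k + 1) ∧ y (k + 1) ≤ y' (k + 1) ∧
      x (k + 1) + (y' 0 - y 0) ≤ x' (k + 1) := by
  induction k with
  | zero =>
    simp only [hy, hy', hx, hx', hx0, hx0', zero_add]
    exact ⟨hy0, by positivity, mul_self_le_mul_self hy0 hyy0, by linarith⟩
  | succ k ih =>
    obtain ⟨hxk, hyk, hyyk, hxxk⟩ := ih
    have hxk' : 0 ≤ x (k + 1 + 1) := by rw [hx]; positivity
    have hgap : x (k + 1 + 1) + (y' 0 - y 0) ≤ x' (k + 1 + 1) := by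
      rw [hx, hx']; linarith
    refine ⟨hxk', ?_, ?_, hgap⟩
    · rw [hy]; positivity
    · rw [hy, hy']
      exact mul_le_mul hyyk (by linarith) hxk' (hyk.trans hyyk)

/-- For the real iteration `x₀(t) = 0`, `y₀(t) = t²`, `x_{k+1} = x_k + y_k`,
`y_{k+1} = y_k · x_{k+1}`, with limit `L(t) = lim_k x_k(t)` for `0 ≤ t < √(2−√3)`:
`L` is strictly increasing on `[0, √(2−√3))`, hence `t ↦ 1 − t − L(t)` is strictly
decreasing there and has at most one zero. -/
theorem limit_strictly_increasing (x y : ℝ → ℕ → ℝ)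
    (hx0 : ∀ t, x t 0 = 0) (hy0 : ∀ t, y t 0 = t ^ 2)
    (hx : ∀ t k, x t (k + 1) = x t k + y t k)
    (hy : ∀ t k, y t (k + 1) = y t k * x t (k + 1))
    (L : ℝ → ℝ)
    (hL : ∀ t : ℝ, 0 ≤ t → t < Real.sqrt (2 - Real.sqrt 3) →
      Tendsto (x t) atTop (nhds (L t))) :
    (∀ s t : ℝ, 0 ≤ s → s < t → t < Real.sqrt (2 - Real.sqrt 3) → L s < L t)
      ∧ StrictAntiOn (fun t => 1 - t - L t)
          (Set.Ico 0 (Real.sqrt (2 - Real.sqrt 3)))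
      ∧ ∀ s t : ℝ, s ∈ Set.Ico (0 : ℝ) (Real.sqrt (2 - Real.sqrt 3)) →
          t ∈ Set.Ico (0 : ℝ) (Real.sqrt (2 - Real.sqrt 3)) →
          1 - s - L s = 0 → 1 - t - L t = 0 → s = t := by
  have key : ∀ s t : ℝ, 0 ≤ s → s < t → t < Real.sqrt (2 - Real.sqrt 3) → L s < L t := by
    intro s t hs hst ht
    have hsq : s ^ 2 < t ^ 2 := by gcongr
    have hgap : ∀ k, x s (k + 1) + (t ^ 2 - s ^ 2) ≤ x t (k + 1) := fun k => by
      have h := (iteration_monotone (hx0 s) (hx0 t) (by rw [hy0]; positivity)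
        (by rw [hy0, hy0]; exact hsq.le) (hx s) (hy s) (hx t) (hy t) k).2.2.2
      rwa [hy0, hy0] at h
    have hlim := le_of_tendsto_of_tendsto'
      (((tendsto_add_atTop_iff_nat 1).2 (hL s hs (hst.trans ht))).add_const (t ^ 2 - s ^ 2))
      ((tendsto_add_atTop_iff_nat 1).2 (hL t (hs.trans hst.le) ht)) hgap
    linarith
  have anti : StrictAntiOn (fun t => 1 - t - L t)
      (Set.Ico 0 (Real.sqrt (2 - Real.sqrt 3))) := by
    intro s hs t ht hst
    have := key s t hs.1 hst ht.2
    dsimp only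
    linarith
  exact ⟨key, anti, fun s t hs ht hs0 ht0 => anti.injOn hs ht (hs0.trans ht0.symm)⟩
end
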